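/- Let β ∈ (0,1) and let ζ(t) be the Markov chain on ℤ² with transitions from (x₁,x₂): to (x₁+1,x₂) with prob. β^{x₁+x₂}/Z, to (x₁,x₂+1) with prob. β^{x₂}/Z, to (x₁−1,x₂−1) with prob. β^{x₁}/Z, Z = β^{x₁+x₂}+β^{x₂}+β^{x₁}. Then ζ is positive recurrent (ergodic). -/

import Mathlib

/-- Transition kernel on ℤ² of the difference chain for the asymmetric
interaction model with `N = 2`. -/
noncomputable def asymKernel (β : ℝ) : ℤ × ℤ → ℤ × ℤ → ℝ := fun x y =>
  let Z : ℝ := β ^ (x.1 + x.2) + β ^ x.2 + β ^ x.1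
  (if y = (x.1 + 1, x.2) then β ^ (x.1 + x.2) / Z else 0)
  + (if y = (x.1, x.2 + 1) then β ^ x.2 / Z else 0)
  + (if y = (x.1 - 1, x.2 - 1) then β ^ x.1 / Z else 0)

open Filter Topology Finset

/-- The average of the first `n` iterates of an operator `P` on functions, evaluated at `x₀`. -/
noncomputable def cesaroEval {α : Type*} (P : (α → ℝ) →ₗ[ℝ] (α → ℝ)) (x₀ : α) (n : ℕ) :
    (α → ℝ) →ₗ[ℝ] ℝ :=
  (n : ℝ)⁻¹ • ∑ k ∈ range n, LinearMap.proj x₀ ∘ₗ (P ^ k)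

section Cesaro

variable {α : Type*} {P : (α → ℝ) →ₗ[ℝ] (α → ℝ)}

theorem cesaroEval_apply (x₀ : α) (n : ℕ) (φ : α → ℝ) :
    cesaroEval P x₀ n φ = (n : ℝ)⁻¹ * ∑ k ∈ range n, (P ^ k) φ x₀ := by
  simp [cesaroEval, LinearMap.sum_apply]

theorem pow_apply_nonneg_of_positive (hP : ∀ φ, 0 ≤ φ → 0 ≤ P φ) (k : ℕ) {φ : α → ℝ}
    (hφ : 0 ≤ φ) : 0 ≤ (P ^ k) φ := by
  induction k with
  | zero => simpa using hφ
  | succ k ih => rw [pow_succ', Module.End.mul_apply]; exact hP _ ih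

theorem pow_apply_one_of_apply_one (hP1 : P 1 = 1) (k : ℕ) : (P ^ k) 1 = 1 := by
  induction k with
  | zero => simp
  | succ k ih => rw [pow_succ', Module.End.mul_apply, ih, hP1]

theorem cesaroEval_nonneg (hP : ∀ φ, 0 ≤ φ → 0 ≤ P φ) (x₀ : α) (n : ℕ) {φ : α → ℝ}
    (hφ : 0 ≤ φ) : 0 ≤ cesaroEval P x₀ n φ := by
  rw [cesaroEval_apply]
  exact mul_nonneg (by positivity)
    (sum_nonneg fun k _ => pow_apply_nonneg_of_positive hP k hφ x₀)

theorem cesaroEval_mono (hP : ∀ φ, 0 ≤ φ → 0 ≤ P φ) (x₀ : α) (n : ℕ) {φ ψ : α → ℝ}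
    (h : φ ≤ ψ) : cesaroEval P x₀ n φ ≤ cesaroEval P x₀ n ψ := by
  have := cesaroEval_nonneg hP x₀ n (sub_nonneg.2 h)
  rw [map_sub] at this
  linarith

theorem cesaroEval_one (hP1 : P 1 = 1) (x₀ : α) {n : ℕ} (hn : n ≠ 0) :
    cesaroEval P x₀ n 1 = 1 := by
  have : (n : ℝ) ≠ 0 := by exact_mod_cast hn
  rw [cesaroEval_apply]
  simp [pow_apply_one_of_apply_one hP1, this]

theorem cesaroEval_apply_sub (x₀ : α) (n : ℕ) (φ : α → ℝ) :
    cesaroEval P x₀ n (P φ) - cesaroEval P x₀ n φ = (n : ℝ)⁻¹ * ((P ^ n) φ x₀ - φ x₀) := by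
  have h : ∀ k, (P ^ k) (P φ) x₀ = (P ^ (k + 1)) φ x₀ := fun k => by
    rw [pow_succ, Module.End.mul_apply]
  rw [cesaroEval_apply, cesaroEval_apply, ← mul_sub, ← sum_sub_distrib]
  simp only [h]
  rw [sum_range_sub (fun k => (P ^ k) φ x₀)]
  simp

theorem tendsto_cesaroEval_apply_sub (hP : ∀ φ, 0 ≤ φ → 0 ≤ P φ) (hP1 : P 1 = 1) (x₀ : α)
    {φ : α → ℝ} (h0 : 0 ≤ φ) (h1 : φ ≤ 1) :
    Tendsto (fun n => cesaroEval P x₀ n (P φ) - cesaroEval P x₀ n φ) atTop (𝓝 0) := by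
  refine squeeze_zero_norm (fun n => ?_) (tendsto_inv_atTop_nhds_zero_nat (𝕜 := ℝ))
  rw [cesaroEval_apply_sub, norm_mul, norm_inv, Real.norm_natCast]
  refine mul_le_of_le_one_right (by positivity) ?_
  have a := pow_apply_nonneg_of_positive hP n h0 x₀
  have b := pow_apply_nonneg_of_positive hP n (sub_nonneg.2 h1) x₀
  have c := h0 x₀
  have d := h1 x₀
  rw [map_sub, pow_apply_one_of_apply_one hP1] at b
  simp only [Pi.zero_apply, Pi.sub_apply, Pi.one_apply] at a b c d
  rw [Real.norm_eq_abs, abs_le]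
  constructor <;> linarith

theorem finset_sum_single_one_le_one [DecidableEq α] (s : Finset α) :
    ∑ y ∈ s, (Pi.single y 1 : α → ℝ) ≤ 1 := by
  intro x
  rw [Finset.sum_apply, Finset.sum_pi_single]
  split_ifs <;> simp

/-- **Foster's criterion**: a positive Markov operator with finitely many predecessors for each
state and a nonnegative Lyapunov function that decreases by one in mean outside a finite set has a
stationary probability distribution. -/
theorem exists_stationary_of_foster [DecidableEq α] [Nonempty α]
    (hP : ∀ φ, 0 ≤ φ → 0 ≤ P φ) (hP1 : P 1 = 1)
    (hfin : ∀ y, (Function.support (P (Pi.single y 1))).Finite)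
    {f : α → ℝ} (hf : 0 ≤ f) (hdrift : {x | f x < P f x + 1}.Finite) :
    ∃ π : α → ℝ, (∀ x, 0 ≤ π x) ∧ HasSum π 1 ∧
      ∀ y, HasSum (fun x => π x * P (Pi.single y 1) x) (π y) := by
  obtain ⟨x₀⟩ := ‹Nonempty α›
  set μ : ℕ → α → ℝ := fun n y => cesaroEval P x₀ n (Pi.single y 1) with hμ
  have single_nonneg : ∀ y : α, (0 : α → ℝ) ≤ Pi.single y 1 := fun y =>
    Pi.single_nonneg.2 zero_le_one
  have single_le_one : ∀ y : α, (Pi.single y 1 : α → ℝ) ≤ 1 := fun y => by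
    simpa using finset_sum_single_one_le_one {y}
  have μ_nonneg : ∀ n y, 0 ≤ μ n y := fun n y => cesaroEval_nonneg hP x₀ n (single_nonneg y)
  have μ_sum_le : ∀ n (s : Finset α), ∑ y ∈ s, μ n y ≤ 1 := fun n s => by
    rcases eq_or_ne n 0 with rfl | hn
    · simp [hμ, cesaroEval]
    · rw [hμ, ← map_sum]
      exact (cesaroEval_mono hP x₀ n (finset_sum_single_one_le_one s)).trans_eq
        (cesaroEval_one hP1 x₀ hn)
  obtain ⟨ρ, -, hρ⟩ := (isCompact_univ_pi fun _ : α => isCompact_Icc (a := (0 : ℝ)) (b := 1))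
    |>.ultrafilter_le_nhds ((hyperfilter ℕ).map μ) (by
      rw [le_principal_iff, Ultrafilter.coe_map, Filter.mem_map]
      refine Eventually.of_forall fun n y _ => ⟨μ_nonneg n y, ?_⟩
      simpa using μ_sum_le n {y})
  have hle : (hyperfilter ℕ : Filter ℕ) ≤ atTop := by
    rw [← Nat.cofinite_eq_atTop]; exact hyperfilter_le_cofinite
  have hlim : ∀ y, Tendsto (fun n => μ n y) (hyperfilter ℕ) (𝓝 (ρ y)) :=
    tendsto_pi_nhds.1 hρ
  have ρ_nonneg : ∀ y, 0 ≤ ρ y := fun y => ge_of_tendsto' (hlim y) fun n => μ_nonneg n y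
  have ρ_sum_le : ∀ s : Finset α, ∑ y ∈ s, ρ y ≤ 1 := fun s =>
    le_of_tendsto' (tendsto_finsetSum s fun y _ => hlim y) fun n => μ_sum_le n s
  have ρ_summable : Summable ρ := summable_of_sum_le ρ_nonneg ρ_sum_le
  have ρ_stationary : ∀ y, HasSum (fun x => ρ x * P (Pi.single y 1) x) (ρ y) := fun y => by
    set S := (hfin y).toFinset with hS
    have hzero : ∀ x ∉ S, P (Pi.single y 1) x = 0 := fun x hx => by
      simpa [hS] using hx
    have hexp : P (Pi.single y 1) = ∑ x ∈ S, P (Pi.single y 1) x • (Pi.single x 1 : α → ℝ) := by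
      ext z
      rw [Finset.sum_apply]
      by_cases hz : z ∈ S
      · simp [Pi.single_apply, hz]
      · simp [Pi.single_apply, hz, hzero z hz]
    have hsum : ∑ x ∈ S, ρ x * P (Pi.single y 1) x = ρ y := by
      have h1 : Tendsto (fun n => ∑ x ∈ S, μ n x * P (Pi.single y 1) x) (hyperfilter ℕ)
          (𝓝 (∑ x ∈ S, ρ x * P (Pi.single y 1) x)) :=
        tendsto_finsetSum S fun x _ => (hlim x).mul_const _
      have h2 := ((tendsto_cesaroEval_apply_sub hP hP1 x₀ (single_nonneg y)
        (single_le_one y)).mono_left hle).add (hlim y)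
      refine tendsto_nhds_unique h1 ?_
      rw [zero_add] at h2
      refine h2.congr fun n => ?_
      rw [hμ, sub_add_cancel]
      conv_lhs => rw [hexp]
      simp [map_sum, mul_comm]
    rw [← hsum]
    exact hasSum_sum_of_ne_finset_zero fun x hx => by rw [hzero x hx, mul_zero]
  have ρ_pos : 0 < ∑' y, ρ y := by
    set C := hdrift.toFinset with hC
    set B : ℝ := 1 + ∑ x ∈ C, |P f x + 1 - f x| with hB
    have B_pos : 0 < B := by
      have : 0 ≤ ∑ x ∈ C, |P f x + 1 - f x| := sum_nonneg fun _ _ => abs_nonneg _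
      linarith
    have hdom : P f ≤ f - 1 + B • ∑ y ∈ C, (Pi.single y 1 : α → ℝ) := by
      intro x
      simp only [Pi.add_apply, Pi.sub_apply, Pi.one_apply, Pi.smul_apply, smul_eq_mul,
        Finset.sum_apply, Finset.sum_pi_single]
      by_cases hx : x ∈ C
      · have := single_le_sum (f := fun x => |P f x + 1 - f x|) (fun _ _ => abs_nonneg _) hx
        have := le_abs_self (P f x + 1 - f x)
        simp only [hx, if_true]
        linarith
      · have : P f x + 1 ≤ f x := by simpa [hC] using hx
        simp only [hx, if_false]
        linarith
    have hlow : ∀ n : ℕ, n ≠ 0 → 1 - (n : ℝ)⁻¹ * f x₀ ≤ B * ∑ y ∈ C, μ n y := fun n hn => by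
      have h1 := cesaroEval_mono hP x₀ n hdom
      have h2 := cesaroEval_apply_sub (P := P) x₀ n f
      have h3 := pow_apply_nonneg_of_positive hP n hf x₀
      rw [map_add, map_sub, map_smul, cesaroEval_one hP1 x₀ hn, map_sum, smul_eq_mul] at h1
      have h4 : 0 ≤ (n : ℝ)⁻¹ * (P ^ n) f x₀ := mul_nonneg (by positivity) h3
      rw [mul_sub] at h2
      linarith
    have hlim1 : Tendsto (fun n : ℕ => 1 - (n : ℝ)⁻¹ * f x₀) (hyperfilter ℕ) (𝓝 1) := by
      have := ((tendsto_inv_atTop_nhds_zero_nat (𝕜 := ℝ)).mul_const (f x₀)).const_sub 1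
      simpa using this.mono_left hle
    have hlim2 := (tendsto_finsetSum C fun y _ => hlim y).const_mul B
    have h1 : 1 ≤ B * ∑ y ∈ C, ρ y :=
      le_of_tendsto_of_tendsto hlim1 hlim2
        (((eventually_ne_atTop 0).filter_mono hle).mono hlow)
    have h2 : 0 < ∑ y ∈ C, ρ y := pos_of_mul_pos_right (zero_lt_one.trans_le h1) B_pos.le
    exact h2.trans_le (ρ_summable.sum_le_tsum C fun y _ => ρ_nonneg y)
  refine ⟨fun x => (∑' y, ρ y)⁻¹ * ρ x, fun x => mul_nonneg (by positivity) (ρ_nonneg x), ?_,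
    fun y => ?_⟩
  · simpa [ρ_pos.ne'] using ρ_summable.hasSum.mul_left (∑' y, ρ y)⁻¹
  · simpa [mul_assoc] using (ρ_stationary y).mul_left (∑' y, ρ y)⁻¹

end Cesaro

/-- The Markov operator of the chain with kernel `asymKernel β`. -/
noncomputable def asymOperator (β : ℝ) : (ℤ × ℤ → ℝ) →ₗ[ℝ] (ℤ × ℤ → ℝ) where
  toFun φ x := (β ^ (x.1 + x.2) * φ (x.1 + 1, x.2) + β ^ x.2 * φ (x.1, x.2 + 1)
    + β ^ x.1 * φ (x.1 - 1, x.2 - 1)) / (β ^ (x.1 + x.2) + β ^ x.2 + β ^ x.1)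
  map_add' φ ψ := by ext x; simp only [Pi.add_apply]; ring
  map_smul' c φ := by ext x; simp only [Pi.smul_apply, smul_eq_mul, RingHom.id_apply]; ring

theorem asymOperator_apply (β : ℝ) (φ : ℤ × ℤ → ℝ) (x : ℤ × ℤ) :
    asymOperator β φ x = (β ^ (x.1 + x.2) * φ (x.1 + 1, x.2) + β ^ x.2 * φ (x.1, x.2 + 1)
      + β ^ x.1 * φ (x.1 - 1, x.2 - 1)) / (β ^ (x.1 + x.2) + β ^ x.2 + β ^ x.1) := rfl

theorem asymOperator_single (β : ℝ) (x y : ℤ × ℤ) :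
    asymOperator β (Pi.single y 1) x = asymKernel β x y := by
  simp only [asymOperator_apply, asymKernel, Pi.single_apply, eq_comm (b := y), mul_ite, mul_one,
    mul_zero, add_div, ite_div, zero_div]

theorem asymKernel_nonneg {β : ℝ} (hβ0 : 0 < β) (x y : ℤ × ℤ) : 0 ≤ asymKernel β x y := by
  unfold asymKernel
  positivity

theorem asymKernel_pos {β : ℝ} (hβ0 : 0 < β) {x y : ℤ × ℤ}
    (h : y = (x.1 + 1, x.2) ∨ y = (x.1, x.2 + 1) ∨ y = (x.1 - 1, x.2 - 1)) :
    0 < asymKernel β x y := by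
  unfold asymKernel
  dsimp only
  rcases h with h | h | h <;> rw [if_pos h] <;> positivity

theorem finite_support_asymOperator_single (β : ℝ) (y : ℤ × ℤ) :
    (Function.support (asymOperator β (Pi.single y 1))).Finite := by
  refine (Set.toFinite {(y.1 - 1, y.2), (y.1, y.2 - 1), (y.1 + 1, y.2 + 1)}).subset fun x hx => ?_
  contrapose! hx
  simp only [Set.mem_insert_iff, Set.mem_singleton_iff, not_or, Prod.ext_iff] at hx
  rw [Function.notMem_support, asymOperator_single, asymKernel]
  simp only [Prod.ext_iff]
  rw [if_neg (by omega), if_neg (by omega), if_neg (by omega)]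
  simp

/-- A sum of exponentials whose Newton polygon makes it a Lyapunov function for `asymKernel β`. -/
noncomputable def asymLyapunov (β : ℝ) (x : ℤ × ℤ) : ℝ :=
  β ^ (-x.1 - x.2) + β ^ (-4 * x.1 + x.2) + β ^ (3 * x.1 - 4 * x.2) + β ^ (x.1 + 4 * x.2)

/-- The dominating (negative) monomials in the drift of `asymLyapunov β`. -/
noncomputable def asymDominant (β : ℝ) (s t : ℤ) : ℝ :=
  β ^ (-t) + β ^ (-4 * s + 2 * t) + β ^ (-3 * s + t) + β ^ (4 * s - 3 * t)
    + β ^ (4 * s - 4 * t) + β ^ (2 * s + 5 * t) + β ^ (s + 5 * t)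

theorem zpow_le_asymDominant {β : ℝ} (hβ0 : 0 < β) (hβ1 : β < 1) {s t e : ℤ}
    (h : -t ≤ e ∨ -4 * s + 2 * t ≤ e ∨ -3 * s + t ≤ e ∨ 4 * s - 3 * t ≤ e ∨ 4 * s - 4 * t ≤ e ∨
      2 * s + 5 * t ≤ e ∨ s + 5 * t ≤ e) :
    β ^ e ≤ asymDominant β s t := by
  have hpos : ∀ n : ℤ, 0 < β ^ n := fun n => zpow_pos hβ0 n
  have hmono : ∀ {a b : ℤ}, a ≤ b → β ^ b ≤ β ^ a := fun h =>
    zpow_le_zpow_right_of_le_one₀ hβ0 hβ1.le h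
  have h1 := hpos (-t)
  have h2 := hpos (-4 * s + 2 * t)
  have h3 := hpos (-3 * s + t)
  have h4 := hpos (4 * s - 3 * t)
  have h5 := hpos (4 * s - 4 * t)
  have h6 := hpos (2 * s + 5 * t)
  have h7 := hpos (s + 5 * t)
  unfold asymDominant
  rcases h with h | h | h | h | h | h | h <;> have := hmono h <;> linarith

/-- The weighted drift of `asymLyapunov β` is bounded by the monomials inside its Newton polygon
minus a multiple of those on the boundary. -/
theorem asymLyapunov_weighted_drift {β : ℝ} (hβ0 : 0 < β) (hβ1 : β < 1) (s t : ℤ) :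
    β ^ (s + t) * (asymLyapunov β (s + 1, t) - asymLyapunov β (s, t))
      + β ^ t * (asymLyapunov β (s, t + 1) - asymLyapunov β (s, t))
      + β ^ s * (asymLyapunov β (s - 1, t - 1) - asymLyapunov β (s, t))
      ≤ β⁻¹ ^ 5 * (1 + β ^ (-s) + β ^ (-3 * s + 2 * t) + β ^ (3 * s - 3 * t)
          + β ^ (2 * s + 4 * t)) - (1 - β) * asymDominant β s t := by
  have hβ := hβ0.ne'
  have hpos : ∀ n : ℤ, 0 < β ^ n := fun n => zpow_pos hβ0 n
  have hpow : ∀ n : ℕ, n ≠ 0 → 1 - β ≤ 1 - β ^ n := fun n hn =>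
    sub_le_sub_left (pow_le_of_le_one hβ0.le hβ1.le hn) 1
  have hinv : ∀ n : ℕ, n ≤ 5 → β⁻¹ ^ n - 1 ≤ β⁻¹ ^ 5 := fun n hn => by
    have := pow_le_pow_right₀ ((one_le_inv₀ hβ0).2 hβ1.le) hn
    linarith
  have expand : β ^ (s + t) * (asymLyapunov β (s + 1, t) - asymLyapunov β (s, t))
      + β ^ t * (asymLyapunov β (s, t + 1) - asymLyapunov β (s, t))
      + β ^ s * (asymLyapunov β (s - 1, t - 1) - asymLyapunov β (s, t))
      = ((β⁻¹ ^ 1 - 1) * 1 + (β⁻¹ ^ 1 - 1) * β ^ (-s) + (β⁻¹ ^ 4 - 1) * β ^ (-3 * s + 2 * t)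
          + (β⁻¹ ^ 4 - 1) * β ^ (3 * s - 3 * t) + (β⁻¹ ^ 5 - 1) * β ^ (2 * s + 4 * t))
        - ((1 - β ^ 2) * β ^ (-t) + (1 - β ^ 1) * β ^ (-4 * s + 2 * t)
          + (1 - β ^ 3) * β ^ (-3 * s + t) + (1 - β ^ 3) * β ^ (4 * s - 3 * t)
          + (1 - β ^ 1) * β ^ (4 * s - 4 * t) + (1 - β ^ 1) * β ^ (2 * s + 5 * t)
          + (1 - β ^ 4) * β ^ (s + 5 * t)) := by
    have hu := (hpos s).ne'
    have hv := (hpos t).ne'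
    simp only [asymLyapunov, zpow_add₀ hβ, zpow_sub₀ hβ, zpow_neg, zpow_mul',
      neg_mul, zpow_ofNat]
    generalize β ^ s = u at *
    generalize β ^ t = v at *
    field_simp
    ring
  have p1 := mul_le_mul_of_nonneg_right (hinv 1 (by norm_num)) zero_le_one
  have p2 := mul_le_mul_of_nonneg_right (hinv 1 (by norm_num)) (hpos (-s)).le
  have p3 := mul_le_mul_of_nonneg_right (hinv 4 (by norm_num)) (hpos (-3 * s + 2 * t)).le
  have p4 := mul_le_mul_of_nonneg_right (hinv 4 (by norm_num)) (hpos (3 * s - 3 * t)).le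
  have p5 := mul_le_mul_of_nonneg_right (hinv 5 le_rfl) (hpos (2 * s + 4 * t)).le
  have n1 := mul_le_mul_of_nonneg_right (hpow 2 (by norm_num)) (hpos (-t)).le
  have n2 := mul_le_mul_of_nonneg_right (hpow 1 (by norm_num)) (hpos (-4 * s + 2 * t)).le
  have n3 := mul_le_mul_of_nonneg_right (hpow 3 (by norm_num)) (hpos (-3 * s + t)).le
  have n4 := mul_le_mul_of_nonneg_right (hpow 3 (by norm_num)) (hpos (4 * s - 3 * t)).le
  have n5 := mul_le_mul_of_nonneg_right (hpow 1 (by norm_num)) (hpos (4 * s - 4 * t)).le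
  have n6 := mul_le_mul_of_nonneg_right (hpow 1 (by norm_num)) (hpos (2 * s + 5 * t)).le
  have n7 := mul_le_mul_of_nonneg_right (hpow 4 (by norm_num)) (hpos (s + 5 * t)).le
  rw [expand, asymDominant]
  simp only [mul_add]
  linarith

theorem asymLyapunov_drift {β : ℝ} (hβ0 : 0 < β) (hβ1 : β < 1) :
    ∃ d : ℕ, ∀ s t : ℤ, (20 * (d : ℤ) ≤ s ∨ s ≤ -20 * d ∨ 20 * (d : ℤ) ≤ t ∨ t ≤ -20 * d) →
      asymOperator β (asymLyapunov β) (s, t) + 1 ≤ asymLyapunov β (s, t) := by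
  have hpos : ∀ n : ℤ, 0 < β ^ n := fun n => zpow_pos hβ0 n
  obtain ⟨d, hd⟩ := exists_pow_lt_of_lt_one
    (show 0 < (1 - β) / (8 * β⁻¹ ^ 5) by have := sub_pos.2 hβ1; positivity) hβ1
  rw [lt_div_iff₀ (by positivity)] at hd
  refine ⟨d, fun s t hst => ?_⟩
  have hinner : ∀ e : ℤ, (-t ≤ e - d ∨ -4 * s + 2 * t ≤ e - d ∨ -3 * s + t ≤ e - d ∨
      4 * s - 3 * t ≤ e - d ∨ 4 * s - 4 * t ≤ e - d ∨ 2 * s + 5 * t ≤ e - d ∨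
      s + 5 * t ≤ e - d) → β ^ e ≤ β ^ d * asymDominant β s t := fun e he => by
    have := mul_le_mul_of_nonneg_left (zpow_le_asymDominant hβ0 hβ1 he) (pow_pos hβ0 d).le
    rwa [← zpow_natCast, ← zpow_add₀ hβ0.ne', add_sub_cancel] at this
  have i1 := hinner 0 (by omega)
  have i2 := hinner (-s) (by omega)
  have i3 := hinner (-3 * s + 2 * t) (by omega)
  have i4 := hinner (3 * s - 3 * t) (by omega)
  have i5 := hinner (2 * s + 4 * t) (by omega)
  have i6 := hinner (s + t) (by omega)
  have i7 := hinner t (by omega)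
  have i8 := hinner s (by omega)
  rw [zpow_zero] at i1
  have hdrift := asymLyapunov_weighted_drift hβ0 hβ1 s t
  have hK : 1 ≤ β⁻¹ ^ 5 := one_le_pow₀ ((one_le_inv₀ hβ0).2 hβ1.le)
  have hZ : 0 < β ^ (s + t) + β ^ t + β ^ s := add_pos (add_pos (hpos _) (hpos _)) (hpos _)
  have hD : 0 ≤ asymDominant β s t := by
    unfold asymDominant
    have := hpos
    positivity
  have hsmall := mul_le_mul_of_nonneg_right hd.le hD
  have hrest := le_mul_of_one_le_left hZ.le hK
  have hsum := mul_le_mul_of_nonneg_left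
    (add_le_add (add_le_add (add_le_add (add_le_add (add_le_add i1 i2) i3) i4) i5)
      (add_le_add (add_le_add i6 i7) i8)) (zero_le_one.trans hK)
  rw [← le_sub_iff_add_le, asymOperator_apply, div_le_iff₀ hZ]
  linarith

/-- Part (1) of Theorem 2: for `0 < β < 1` the chain is positive recurrent
(ergodic); for an irreducible aperiodic countable chain this is equivalent to
the existence of a (strictly positive) stationary probability distribution. -/
theorem stmt_6 (β : ℝ) (hβ0 : 0 < β) (hβ1 : β < 1) :
    ∃ π : ℤ × ℤ → ℝ, (∀ x, 0 < π x) ∧ HasSum π 1 ∧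
      ∀ y, HasSum (fun x => π x * asymKernel β x y) (π y) := by
  have hpos : ∀ n : ℤ, 0 < β ^ n := fun n => zpow_pos hβ0 n
  have hZ : ∀ x : ℤ × ℤ, 0 < β ^ (x.1 + x.2) + β ^ x.2 + β ^ x.1 := fun x =>
    add_pos (add_pos (hpos _) (hpos _)) (hpos _)
  obtain ⟨d, hd⟩ := asymLyapunov_drift hβ0 hβ1
  obtain ⟨π, hπ0, hπ1, hπ⟩ := exists_stationary_of_foster (P := asymOperator β)
    (f := asymLyapunov β)
    (fun φ hφ x => div_nonneg
      (add_nonneg (add_nonneg (mul_nonneg (hpos _).le (hφ _)) (mul_nonneg (hpos _).le (hφ _)))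
        (mul_nonneg (hpos _).le (hφ _))) (hZ x).le)
    (by ext x; simp [asymOperator_apply, (hZ x).ne'])
    (finite_support_asymOperator_single β)
    (fun x => by
      have := hpos (-x.1 - x.2)
      have := hpos (-4 * x.1 + x.2)
      have := hpos (3 * x.1 - 4 * x.2)
      have := hpos (x.1 + 4 * x.2)
      simp only [asymLyapunov, Pi.zero_apply]
      positivity)
    (by
      refine (Set.finite_Icc ((-20 * d, -20 * d) : ℤ × ℤ) (20 * d, 20 * d)).subset ?_
      rintro ⟨s, t⟩ hst
      by_contra hbox
      simp only [Set.mem_Icc, Prod.mk_le_mk] at hbox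
      exact absurd hst (not_lt.2 (hd s t (by omega))))
  simp only [asymOperator_single] at hπ
  have hstep : ∀ x y, 0 < asymKernel β x y → 0 < π x → 0 < π y := fun x y hxy hx =>
    (mul_pos hx hxy).trans_le
      (le_hasSum (hπ y) x fun z _ => mul_nonneg (hπ0 z) (asymKernel_nonneg hβ0 z y))
  refine ⟨π, ?_, hπ1, hπ⟩
  obtain ⟨x, hx⟩ : ∃ x, 0 < π x := by
    by_contra! h
    have hzero : π = 0 := funext fun x => le_antisymm (h x) (hπ0 x)
    exact zero_ne_one (hasSum_zero.unique (hzero ▸ hπ1))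
  have right : ∀ n : ℕ, ∀ a b : ℤ, 0 < π (a, b) → 0 < π (a + n, b) := fun n a b h => by
    induction n with
    | zero => simpa using h
    | succ n ih =>
      rw [Nat.cast_succ, ← add_assoc]
      exact hstep _ _ (asymKernel_pos hβ0 (Or.inl rfl)) ih
  have up : ∀ n : ℕ, ∀ a b : ℤ, 0 < π (a, b) → 0 < π (a, b + n) := fun n a b h => by
    induction n with
    | zero => simpa using h
    | succ n ih =>
      rw [Nat.cast_succ, ← add_assoc]
      exact hstep _ _ (asymKernel_pos hβ0 (Or.inr (Or.inl rfl))) ih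
  have down : ∀ n : ℕ, ∀ a b : ℤ, 0 < π (a, b) → 0 < π (a - n, b - n) := fun n a b h => by
    induction n with
    | zero => simpa using h
    | succ n ih =>
      rw [Nat.cast_succ, ← sub_sub, ← sub_sub]
      exact hstep _ _ (asymKernel_pos hβ0 (Or.inr (Or.inr rfl))) ih
  rintro ⟨c, e⟩
  obtain ⟨n, h1, h2⟩ : ∃ n : ℕ, x.1 - n ≤ c ∧ x.2 - n ≤ e :=
    ⟨(x.1 - c).toNat + (x.2 - e).toNat, by omega, by omega⟩
  obtain ⟨k, hk⟩ := Int.le.dest h1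
  obtain ⟨l, hl⟩ := Int.le.dest h2
  simpa [hk, hl] using up l _ _ (right k _ _ (down n _ _ hx))
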